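/- The number of Lyndon words of length m over an alphabet of size n equals (1/m) Σ_{d | m} μ(d) n^{m/d}, where μ is the Möbius function. -/

import Mathlib

/-- A word is a Lyndon word if it is nonempty and strictly smaller (lexicographically)
than every proper nonempty suffix of itself. -/
def IsLyndon {α : Type*} [LinearOrder α] (u : List α) : Prop :=
  u ≠ [] ∧ ∀ v w : List α, v ≠ [] → w ≠ [] → u = v ++ w → List.Lex (· < ·) u w

theorem lex_append_or {α : Type*} [LinearOrder α] {a b : List α} (h : a < b) :
    a <+: b ∨ ∀ x y, a ++ x < b ++ y := by
  change List.Lex (· < ·) a b at h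
  induction h with
  | nil => left; exact List.nil_prefix
  | cons h ih =>
    rcases ih with ih | ih
    · left; exact (List.prefix_cons_inj _).2 ih
    · right; intro x y; exact List.Lex.cons (ih x y)
  | rel h => right; intro x y; exact List.Lex.rel h

theorem lex_append_of_length {α : Type*} [LinearOrder α] {a b : List α} (h : a < b)
    (hl : a.length = b.length) (x y : List α) : a ++ x < b ++ y := by
  rcases lex_append_or h with h' | h'
  · exact absurd (h'.eq_of_length hl) h.ne
  · exact h' x y

theorem isLyndon_iff_rotate {α : Type*} [LinearOrder α] (u : List α) (hu : u ≠ []) :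
    IsLyndon u ↔ ∀ k, 0 < k → k < u.length → u < u.rotate k := by
  constructor
  · intro h k hk hk'
    rw [List.rotate_eq_drop_append_take hk'.le]
    apply List.Lex.append_right
    apply h.2 (u.take k) (u.drop k)
    · intro h0
      have := congrArg List.length h0
      rw [List.length_take, List.length_nil] at this; omega
    · intro h0
      have := congrArg List.length h0
      simp at this; omega
    · simp
  · intro h
    refine ⟨hu, fun v w hv hw e => ?_⟩
    change u < w
    have hv' := List.length_pos_iff.2 hv
    have hw' := List.length_pos_iff.2 hw
    have hlen : u.length = v.length + w.length := by simp [e]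
    by_contra hc
    have hlt : w < u := by
      refine lt_of_le_of_ne (not_lt.1 hc) fun h => ?_
      rw [h] at hlen; omega
    have h1 : u < w ++ v := by
      have := h v.length hv' (by omega)
      rwa [e, List.rotate_append_length_eq, ← e] at this
    rcases lex_append_or hlt with ⟨v', e'⟩ | hp
    · have hlen' : u.length = w.length + v'.length := by simp [← e']
      have h2 : u < v' ++ w := by
        have := h w.length hw' (by omega)
        rwa [← e', List.rotate_append_length_eq, e'] at this
      rcases lt_trichotomy v v' with hvv | hvv | hvv
      · have : w ++ v < w ++ v' := List.append_left_lt hvv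
        rw [e'] at this
        exact lt_asymm this h1
      · rw [← hvv, ← e] at h2
        exact lt_irrefl _ h2
      · have := lex_append_of_length hvv (by omega) w w
        rw [← e] at this
        exact lt_asymm this h2
    · have := hp v []
      rw [List.append_nil] at this
      exact lt_asymm this h1

/-- The shift on sequences. -/
def seqShift {α : Type*} (f : ℕ → α) : ℕ → α := fun i => f (i + 1)

theorem seqShift_iterate {α : Type*} (k : ℕ) (f : ℕ → α) (i : ℕ) :
    seqShift^[k] f i = f (i + k) := by
  induction k generalizing f with
  | zero => rfl
  | succ k ih =>
    rw [Function.iterate_succ_apply, ih]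
    simp [seqShift, add_assoc]

/-- First `d` letters of a sequence. -/
def seqWord {α : Type*} (d : ℕ) (f : ℕ → α) : List α := List.ofFn (fun i : Fin d => f i)

theorem seqWord_length {α : Type*} (d : ℕ) (f : ℕ → α) : (seqWord d f).length = d := by
  simp [seqWord]

theorem per_mod {α : Type*} {d : ℕ} {f : ℕ → α} (hf : Function.IsPeriodicPt seqShift d f)
    (i : ℕ) : f (i % d) = f i := by
  have h : ∀ q j, f (j + d * q) = f j := by
    intro q j
    rw [← seqShift_iterate (d * q) f j, (hf.mul_const q).eq]
  conv_rhs => rw [← Nat.mod_add_div i d]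
  rw [h]

theorem seqWord_shift {α : Type*} {d : ℕ} {f : ℕ → α}
    (hf : Function.IsPeriodicPt seqShift d f) (k : ℕ) :
    seqWord d (seqShift^[k] f) = (seqWord d f).rotate k := by
  apply List.ext_getElem
  · simp [seqWord]
  · intro i h1 h2
    rw [List.getElem_rotate]
    simp [seqWord, seqShift_iterate, per_mod hf]

theorem seqWord_inj {α : Type*} {d : ℕ} (hd : 0 < d) {f g : ℕ → α}
    (hf : Function.IsPeriodicPt seqShift d f) (hg : Function.IsPeriodicPt seqShift d g)
    (h : seqWord d f = seqWord d g) : f = g := by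
  funext i
  have := congrFun (List.ofFn_injective h) ⟨i % d, Nat.mod_lt _ hd⟩
  simpa [per_mod hf, per_mod hg] using this

/-- Periodic sequences correspond to functions on `Fin d`. -/
noncomputable def perEquiv (α : Type*) (d : ℕ) (hd : 0 < d) :
    {f : ℕ → α // Function.IsPeriodicPt seqShift d f} ≃ (Fin d → α) where
  toFun f := fun i => f.1 i
  invFun g := ⟨fun i => g ⟨i % d, Nat.mod_lt _ hd⟩, by
    funext i
    rw [seqShift_iterate]
    simp⟩
  left_inv f := by
    ext i
    simp [per_mod f.2]
  right_inv g := by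
    ext i
    simp [Nat.mod_eq_of_lt i.2]

theorem lyndon_lt_shift {α : Type*} [LinearOrder α] {d : ℕ} {f : ℕ → α}
    (hf : Function.IsPeriodicPt seqShift d f) (hl : IsLyndon (seqWord d f)) (k : ℕ)
    (hk : k % d ≠ 0) : seqWord d f < seqWord d (seqShift^[k] f) := by
  have hd : 0 < d := by
    have := List.length_pos_iff.2 hl.1
    rwa [seqWord_length] at this
  rw [seqWord_shift hf, ← List.rotate_mod, seqWord_length]
  refine (isLyndon_iff_rotate _ hl.1).1 hl _ (Nat.pos_of_ne_zero hk) ?_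
  rw [seqWord_length]
  exact Nat.mod_lt _ hd

theorem lyndon_minimalPeriod {α : Type*} [LinearOrder α] {d : ℕ} (hd : 0 < d) {f : ℕ → α}
    (hf : Function.IsPeriodicPt seqShift d f) (hl : IsLyndon (seqWord d f)) :
    Function.minimalPeriod seqShift f = d := by
  have hdv := hf.minimalPeriod_dvd
  by_contra hne
  have hlt := lt_of_le_of_ne (Nat.le_of_dvd hd hdv) hne
  have hpos := hf.minimalPeriod_pos hd
  have := lyndon_lt_shift hf hl (Function.minimalPeriod seqShift f)
    (by rw [Nat.mod_eq_of_lt hlt]; omega)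
  rw [Function.iterate_minimalPeriod] at this
  exact lt_irrefl _ this

theorem per_shift {α : Type*} {d : ℕ} {f : ℕ → α}
    (hf : Function.IsPeriodicPt seqShift d f) (k : ℕ) :
    Function.IsPeriodicPt seqShift d (seqShift^[k] f) := hf.apply_iterate k

/-- Orbit decomposition. -/
noncomputable def lynMap (α : Type*) [LinearOrder α] (d : ℕ) (hd : 0 < d) :
    Fin d × {f : ℕ → α // Function.IsPeriodicPt seqShift d f ∧ IsLyndon (seqWord d f)} →
      {f : ℕ → α // Function.minimalPeriod seqShift f = d} := fun p =>
  ⟨seqShift^[p.1] p.2.1, by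
    rw [Function.minimalPeriod_apply_iterate]
    · exact lyndon_minimalPeriod hd p.2.2.1 p.2.2.2
    · exact ⟨d, hd, p.2.2.1⟩⟩

theorem lynMap_bij (α : Type*) [LinearOrder α] (d : ℕ) (hd : 0 < d) :
    Function.Bijective (lynMap α d hd) := by
  constructor
  · rintro ⟨k, f, hf, hlf⟩ ⟨l, g, hg, hlg⟩ h
    have h : seqShift^[k] f = seqShift^[l] g := congrArg Subtype.val h
    have hk := k.2
    have hl := l.2
    have e1 : g = seqShift^[(d - l) + k] f := by
      rw [Function.iterate_add_apply, h, ← Function.iterate_add_apply, Nat.sub_add_cancel hl.le]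
      exact hg.eq.symm
    have e2 : f = seqShift^[(d - k) + l] g := by
      rw [Function.iterate_add_apply, ← h, ← Function.iterate_add_apply, Nat.sub_add_cancel hk.le]
      exact hf.eq.symm
    have hkl : (k : ℕ) = l := by
      by_contra hne
      have m1 : ((d - l) + k) % d ≠ 0 := by
        intro h0
        obtain ⟨c, hc⟩ := Nat.dvd_of_mod_eq_zero h0
        have : 0 < c := by by_contra h; simp at h; subst h; omega
        have : c < 2 := by
          by_contra h
          have : d * 2 ≤ d * c := Nat.mul_le_mul_left d (by omega)
          omega
        have : c = 1 := by omega
        subst this; omega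
      have m2 : ((d - k) + l) % d ≠ 0 := by
        intro h0
        obtain ⟨c, hc⟩ := Nat.dvd_of_mod_eq_zero h0
        have : 0 < c := by by_contra h; simp at h; subst h; omega
        have : c < 2 := by
          by_contra h
          have : d * 2 ≤ d * c := Nat.mul_le_mul_left d (by omega)
          omega
        have : c = 1 := by omega
        subst this; omega
      have l1 := lyndon_lt_shift hf hlf _ m1
      have l2 := lyndon_lt_shift hg hlg _ m2
      rw [← e1] at l1
      rw [← e2] at l2
      exact lt_asymm l1 l2
    have hkl' : k = l := Fin.ext hkl
    subst hkl'
    rw [Nat.sub_add_cancel hk.le, hf.eq] at e1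
    subst e1
    rfl
  · rintro ⟨f, hf⟩
    have hp : Function.IsPeriodicPt seqShift d f := hf ▸ Function.isPeriodicPt_minimalPeriod _ _
    obtain ⟨k, hk, hmin⟩ := Finset.exists_min_image (Finset.range d)
      (fun k => seqWord d (seqShift^[k] f)) ⟨0, by simpa using hd⟩
    rw [Finset.mem_range] at hk
    have hmin' : ∀ j, seqWord d (seqShift^[k] f) ≤ seqWord d (seqShift^[j] f) := by
      intro j
      have := hmin (j % d) (Finset.mem_range.2 (Nat.mod_lt _ hd))
      rwa [hp.iterate_mod_apply] at this
    have hly : IsLyndon (seqWord d (seqShift^[k] f)) := by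
      rw [isLyndon_iff_rotate]
      · intro j hj hj'
        rw [seqWord_length] at hj'
        rw [← seqWord_shift (per_shift hp k), ← Function.iterate_add_apply]
        refine lt_of_le_of_ne (hmin' _) fun e => ?_
        have e := seqWord_inj hd (per_shift hp _) (per_shift hp _) e
        rw [Function.iterate_add_apply] at e
        have hdv := Function.IsPeriodicPt.minimalPeriod_dvd
          (show Function.IsPeriodicPt seqShift j (seqShift^[k] f) from e.symm)
        rw [Function.minimalPeriod_apply_iterate ⟨d, hd, hp⟩, hf] at hdv
        exact absurd (Nat.le_of_dvd hj hdv) (by omega)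
      · intro h0
        have := seqWord_length d (seqShift^[k] f)
        rw [h0] at this
        simp at this; omega
    refine ⟨⟨⟨(d - k) % d, Nat.mod_lt _ hd⟩, _, per_shift hp k, hly⟩, Subtype.ext ?_⟩
    change seqShift^[(d - k) % d] (seqShift^[k] f) = f
    rw [(per_shift hp k).iterate_mod_apply, ← Function.iterate_add_apply,
      Nat.sub_add_cancel hk.le]
    exact hp.eq

theorem card_lyndon_seq (α : Type*) [LinearOrder α] (d : ℕ) (hd : 0 < d) :
    Nat.card {f : ℕ → α // Function.IsPeriodicPt seqShift d f ∧ IsLyndon (seqWord d f)} =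
      Nat.card {u : List α // u.length = d ∧ IsLyndon u} := by
  apply Nat.card_congr
  refine Equiv.ofBijective (fun f => ⟨seqWord d f.1, seqWord_length d f.1, f.2.2⟩) ⟨?_, ?_⟩
  · rintro ⟨f, hf, hlf⟩ ⟨g, hg, hlg⟩ h
    exact Subtype.ext (seqWord_inj hd hf hg (congrArg Subtype.val h))
  · rintro ⟨u, hu, hl⟩
    let g : Fin d → α := fun i => u.get ⟨i, by omega⟩
    have hw : seqWord d ((perEquiv α d hd).symm g).1 = u := by
      have h := (perEquiv α d hd).apply_symm_apply g
      change List.ofFn (perEquiv α d hd ((perEquiv α d hd).symm g)) = u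
      rw [h]
      apply List.ext_getElem <;> simp [g, hu]
    exact ⟨⟨_, ((perEquiv α d hd).symm g).2, by rw [hw]; exact hl⟩, Subtype.ext hw⟩

theorem card_minPeriod (α : Type*) [LinearOrder α] (d : ℕ) (hd : 0 < d) :
    Nat.card {f : ℕ → α // Function.minimalPeriod seqShift f = d} =
      d * Nat.card {u : List α // u.length = d ∧ IsLyndon u} := by
  rw [← Nat.card_congr (Equiv.ofBijective _ (lynMap_bij α d hd)), Nat.card_prod,
    card_lyndon_seq α d hd, Nat.card_fin]

theorem sum_minPeriod (n m : ℕ) (hm : 0 < m) :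
    ∑ d ∈ m.divisors, Nat.card {f : ℕ → Fin n // Function.minimalPeriod seqShift f = d} =
      n ^ m := by
  have hfin : ∀ d : m.divisors,
      Finite {f : ℕ → Fin n // Function.minimalPeriod seqShift f = d} := by
    rintro ⟨d, hd⟩
    have hd := Nat.pos_of_mem_divisors hd
    have : Finite {f : ℕ → Fin n // Function.IsPeriodicPt seqShift d f} :=
      Finite.of_equiv _ (perEquiv (Fin n) d hd).symm
    exact Finite.of_injective
      (fun f : {f : ℕ → Fin n // Function.minimalPeriod seqShift f = d} =>
        (⟨f.1, by
          have := Function.isPeriodicPt_minimalPeriod seqShift f.1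
          rwa [f.2] at this⟩ : {f : ℕ → Fin n // Function.IsPeriodicPt seqShift d f}))
      (fun a b h => Subtype.ext (by simpa using h))
  rw [← Finset.sum_coe_sort, ← Nat.card_sigma]
  have h2 : Nat.card {f : ℕ → Fin n // Function.IsPeriodicPt seqShift m f} = n ^ m := by
    rw [Nat.card_congr (perEquiv (Fin n) m hm)]
    simp
  rw [← h2]
  apply Nat.card_congr
  refine Equiv.ofBijective (fun p => ⟨p.2.1, ?_⟩) ⟨?_, ?_⟩
  · rw [Function.isPeriodicPt_iff_minimalPeriod_dvd, p.2.2]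
    exact Nat.dvd_of_mem_divisors p.1.2
  · rintro ⟨⟨d, hd⟩, f, hf⟩ ⟨⟨e, he⟩, g, hg⟩ h
    have h : f = g := congrArg Subtype.val h
    subst h
    dsimp only at hf hg
    subst hf
    subst hg
    rfl
  · rintro ⟨f, hf⟩
    exact ⟨⟨⟨_, Nat.mem_divisors.2 ⟨hf.minimalPeriod_dvd, hm.ne'⟩⟩, f, rfl⟩, rfl⟩

/-- The number of Lyndon words of length `m` over an alphabet of size `n` satisfies
`m · #Lyndon = Σ_{d ∣ m} μ(d) n^{m/d}`. -/
theorem card_lyndon_words (n m : ℕ) (hm : 1 ≤ m) :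
    (m : ℤ) * Nat.card {u : List (Fin n) // u.length = m ∧ IsLyndon u} =
      ∑ d ∈ m.divisors, (ArithmeticFunction.moebius d : ℤ) * (n : ℤ) ^ (m / d) := by
  have key := (ArithmeticFunction.sum_eq_iff_sum_mul_moebius_eq (R := ℤ)
    (f := fun d => (d : ℤ) * Nat.card {u : List (Fin n) // u.length = d ∧ IsLyndon u})
    (g := fun d => (n : ℤ) ^ d)).1 (by
      intro k hk
      rw [← Nat.cast_pow, ← sum_minPeriod n k hk, Nat.cast_sum]
      refine Finset.sum_congr rfl fun d hd => ?_
      rw [card_minPeriod _ d (Nat.pos_of_mem_divisors hd), Nat.cast_mul]) m hm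
  rw [← key]
  exact Nat.sum_divisorsAntidiagonal
    (fun a b => (ArithmeticFunction.moebius a : ℤ) * (n : ℤ) ^ b)
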